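/- Let (M,g) be asymptotically flat with decay rate τ > 1/2 in coordinates x' = (x₁', x₂', x₃'), and let u = x₃' be harmonic for g. Then the metric coefficients satisfy the asymptotic identity g_{33,3} = −2g_{31,1} − 2g_{32,2} + g_{11,3} + g_{22,3} + O(|x'|^{−1−2τ}) as |x'| → ∞. -/

import Mathlib

set_option autoImplicit false

/-!
The asymptotic identity satisfied by the metric coefficients when the coordinate
function `u = x₃'` is harmonic:
`g_{33,3} = −2g_{31,1} − 2g_{32,2} + g_{11,3} + g_{22,3} + O(|x'|^{−1−2τ})`.
-/

noncomputable section

/-- The chart region `ℝ³₊ \ B₁⁺(0)` at infinity. -/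
def ChartRegion : Set (EuclideanSpace ℝ (Fin 3)) := {x | 0 ≤ x 2 ∧ 1 ≤ ‖x‖}

/-- The inverse metric `g^{ij}`, obtained by inverting the matrix of coefficients. -/
def ginv (g : EuclideanSpace ℝ (Fin 3) → Fin 3 → Fin 3 → ℝ)
    (x : EuclideanSpace ℝ (Fin 3)) : Matrix (Fin 3) (Fin 3) ℝ :=
  (Matrix.of fun i j => g x i j)⁻¹

/-- If every entry of `A - 1` is at most `ε ≤ 1 / 6`, every entry of `A⁻¹ - 1` is at most `6 ε`. -/
theorem abs_inv_sub_one_le_of_abs_sub_one_le (A : Matrix (Fin 3) (Fin 3) ℝ) {ε : ℝ}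
    (hε : ε ≤ 1 / 6) (hA : ∀ i j, |A i j - (1 : Matrix (Fin 3) (Fin 3) ℝ) i j| ≤ ε)
    (i j : Fin 3) : |A⁻¹ i j - (1 : Matrix (Fin 3) (Fin 3) ℝ) i j| ≤ 6 * ε := by
  have hε0 : 0 ≤ ε := (abs_nonneg _).trans (hA 0 0)
  have hdet : A.det ≠ 0 := by
    apply det_ne_zero_of_sum_row_lt_diag
    intro k
    have hdiag : 1 - ε ≤ ‖A k k‖ := by
      have h := hA k k
      rw [Matrix.one_apply_eq, abs_le] at h
      rw [Real.norm_eq_abs]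
      linarith [le_abs_self (A k k), h.1]
    have hoff : ∑ l ∈ Finset.univ.erase k, ‖A k l‖ ≤ ∑ l ∈ Finset.univ.erase k, ε := by
      refine Finset.sum_le_sum fun l hl => ?_
      have h := hA k l
      rwa [Matrix.one_apply_ne (Finset.ne_of_mem_erase hl).symm, sub_zero] at h
    have hsum : ∑ l ∈ Finset.univ.erase k, ε = 2 * ε := by simp
    linarith
  have hmul : A * A⁻¹ = 1 := Matrix.mul_nonsing_inv A (isUnit_iff_ne_zero.mpr hdet)
  obtain ⟨p, hp⟩ := Finite.exists_max fun q : Fin 3 × Fin 3 => |A⁻¹ q.1 q.2|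
  have key : ∀ k l, |A⁻¹ k l - (1 : Matrix (Fin 3) (Fin 3) ℝ) k l| ≤
      3 * (ε * |A⁻¹ p.1 p.2|) := by
    intro k l
    have hrepr : A⁻¹ - 1 = -((A - 1) * A⁻¹) := by rw [sub_mul, hmul, one_mul, neg_sub]
    rw [← Matrix.sub_apply, hrepr, Matrix.neg_apply, abs_neg, Matrix.mul_apply]
    refine (Finset.abs_sum_le_sum_abs _ _).trans ?_
    refine (Finset.sum_le_card_nsmul _ _ (ε * |A⁻¹ p.1 p.2|) fun m _ => ?_).trans (by simp)
    rw [abs_mul]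
    exact mul_le_mul (hA k m) (hp (m, l)) (abs_nonneg _) hε0
  have hone : |(1 : Matrix (Fin 3) (Fin 3) ℝ) p.1 p.2| ≤ 1 := by
    rw [Matrix.one_apply]
    split_ifs <;> simp
  have hmax : |A⁻¹ p.1 p.2| ≤ 2 := by
    have h := key p.1 p.2
    have h2 := abs_sub_abs_le_abs_sub (A⁻¹ p.1 p.2) ((1 : Matrix (Fin 3) (Fin 3) ℝ) p.1 p.2)
    nlinarith [abs_nonneg (A⁻¹ p.1 p.2)]
  nlinarith [key i j]

/-- **Asymptotics of a harmonic coordinate.**  Let `g` be asymptotically flat of decay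
rate `τ > 1/2` in the coordinates `x' = (x₁',x₂',x₃')` (indices `0,1,2` below) and
suppose the coordinate `u = x₃'` is harmonic for `g`, i.e.
`0 = g^{ij} g(∇_{∂_i}∇u, ∂_j) = −g^{ij} g^{3l}(g_{li,j} + g_{lj,i} − g_{ij,l})/2 ⋅ (…)`.
Then `g_{33,3} = −2g_{31,1} − 2g_{32,2} + g_{11,3} + g_{22,3} + O(|x'|^{−1−2τ})`
as `|x'| → ∞`. -/
theorem harmonic_coordinate_metric_asymptotics
    (τ : ℝ) (hτ : 1 / 2 < τ)
    (g : EuclideanSpace ℝ (Fin 3) → Fin 3 → Fin 3 → ℝ)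
    (dg : EuclideanSpace ℝ (Fin 3) → Fin 3 → Fin 3 → Fin 3 → ℝ)
    (ddg : EuclideanSpace ℝ (Fin 3) → Fin 3 → Fin 3 → Fin 3 → Fin 3 → ℝ)
    (hsymm : ∀ x i j, g x i j = g x j i)
    -- `dg x i j k = g_{ij,k}` is the partial derivative of `g_ij` in the direction `k`:
    (hdg : ∀ x ∈ ChartRegion, ∀ i j k,
      dg x i j k = fderiv ℝ (fun y => g y i j) x (EuclideanSpace.single k 1))
    (hddg : ∀ x ∈ ChartRegion, ∀ i j k l,
      ddg x i j k l = fderiv ℝ (fun y => dg y i j k) x (EuclideanSpace.single l 1))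
    -- asymptotic flatness `|g_ij − δ_ij| + r|g_ij,k| + r²|g_ij,kl| = O(r^{−τ})`:
    (hdecay : ∃ C : ℝ, 0 < C ∧ ∀ x ∈ ChartRegion, ∀ i j k l,
      |g x i j - (if i = j then (1:ℝ) else 0)| + ‖x‖ * |dg x i j k|
        + ‖x‖ ^ 2 * |ddg x i j k l| ≤ C * ‖x‖ ^ (-τ))
    -- harmonicity of `u = x₃'`: `g^{ij} g^{3l}(g_{li,j} + g_{lj,i} − g_{ij,l}) = 0`:
    (hharm : ∀ x ∈ ChartRegion,
      ∑ i, ∑ j, ∑ l, ginv g x i j * ginv g x 2 l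
        * (dg x l i j + dg x l j i - dg x i j l) = 0) :
    ∃ C : ℝ, 0 < C ∧ ∃ R : ℝ, ∀ x ∈ ChartRegion, R ≤ ‖x‖ →
      |dg x 2 2 2 - (-2 * dg x 2 0 0 - 2 * dg x 2 1 1 + dg x 0 0 2 + dg x 1 1 2)|
        ≤ C * ‖x‖ ^ (-1 - 2 * τ) := by
  obtain ⟨C, hC, hdecay⟩ := hdecay
  have hlim : Filter.Tendsto (fun r : ℝ => C * r ^ (-τ)) Filter.atTop (nhds 0) := by
    simpa using (tendsto_rpow_neg_atTop (by linarith : 0 < τ)).const_mul C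
  obtain ⟨R, hR⟩ := Filter.eventually_atTop.mp (hlim.eventually_le_const
    (by norm_num : (0:ℝ) < 1 / 6))
  refine ⟨27 * (18 * C * (3 * C)), by positivity, R, fun x hx hxR => ?_⟩
  have hr : 0 < ‖x‖ := lt_of_lt_of_le one_pos hx.2
  set ε := C * ‖x‖ ^ (-τ) with hε
  have hε0 : 0 ≤ ε := by positivity
  have hε6 : ε ≤ 1 / 6 := hR _ hxR
  have hg : ∀ i j, |g x i j - (1 : Matrix (Fin 3) (Fin 3) ℝ) i j| ≤ ε := by
    intro i j
    rw [Matrix.one_apply]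
    have := hdecay x hx i j 0 0
    have h1 : 0 ≤ ‖x‖ * |dg x i j 0| := by positivity
    have h2 : 0 ≤ ‖x‖ ^ 2 * |ddg x i j 0 0| := by positivity
    linarith
  have hinv : ∀ i j, |ginv g x i j - (1 : Matrix (Fin 3) (Fin 3) ℝ) i j| ≤ 6 * ε :=
    abs_inv_sub_one_le_of_abs_sub_one_le (Matrix.of fun i j => g x i j) hε6 hg
  set δ := ε / ‖x‖ with hδ
  have hd : ∀ i j k, |dg x i j k| ≤ δ := by
    intro i j k
    rw [hδ, le_div_iff₀ hr]
    have := hdecay x hx i j k 0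
    have h1 := abs_nonneg (g x i j - (if i = j then (1:ℝ) else 0))
    have h2 : 0 ≤ ‖x‖ ^ 2 * |ddg x i j k 0| := by positivity
    linarith
  have hone : ∀ i j, |(1 : Matrix (Fin 3) (Fin 3) ℝ) i j| ≤ 1 := by
    intro i j
    rw [Matrix.one_apply]
    split_ifs <;> simp
  have hterm : ∀ i j l, |((1 : Matrix (Fin 3) (Fin 3) ℝ) i j * (1 : Matrix (Fin 3) (Fin 3) ℝ) 2 l
      - ginv g x i j * ginv g x 2 l) * (dg x l i j + dg x l j i - dg x i j l)|
      ≤ 18 * ε * (3 * δ) := by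
    intro i j l
    rw [abs_mul]
    refine mul_le_mul ?_ ?_ (abs_nonneg _) (by positivity)
    · have hsplit : (1 : Matrix (Fin 3) (Fin 3) ℝ) i j * (1 : Matrix (Fin 3) (Fin 3) ℝ) 2 l
          - ginv g x i j * ginv g x 2 l
          = -((ginv g x i j - (1 : Matrix (Fin 3) (Fin 3) ℝ) i j) * ginv g x 2 l
            + (1 : Matrix (Fin 3) (Fin 3) ℝ) i j
              * (ginv g x 2 l - (1 : Matrix (Fin 3) (Fin 3) ℝ) 2 l)) := by ring
      rw [hsplit, abs_neg]
      refine (abs_add_le _ _).trans ?_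
      rw [abs_mul, abs_mul]
      have hb : |ginv g x 2 l| ≤ 2 := by
        have := abs_sub_abs_le_abs_sub (ginv g x 2 l) ((1 : Matrix (Fin 3) (Fin 3) ℝ) 2 l)
        linarith [hinv 2 l, hone 2 l]
      have h1 := mul_le_mul (hinv i j) hb (abs_nonneg _) (by positivity)
      have h2 := mul_le_mul (hone i j) (hinv 2 l) (abs_nonneg _) zero_le_one
      linarith
    · refine (abs_sub _ _).trans ?_
      linarith [abs_add_le (dg x l i j) (dg x l j i), hd l i j, hd l j i, hd i j l]
  have hexpand : dg x 2 2 2 - (-2 * dg x 2 0 0 - 2 * dg x 2 1 1 + dg x 0 0 2 + dg x 1 1 2)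
      = ∑ i, ∑ j, ∑ l, ((1 : Matrix (Fin 3) (Fin 3) ℝ) i j * (1 : Matrix (Fin 3) (Fin 3) ℝ) 2 l
        - ginv g x i j * ginv g x 2 l) * (dg x l i j + dg x l j i - dg x i j l) := by
    simp only [sub_mul _ _ (_ - _), Finset.sum_sub_distrib, hharm x hx, sub_zero]
    simp [Fin.sum_univ_three, Matrix.one_apply]
    ring
  have hpow : ‖x‖ ^ (-1 - 2 * τ) = ‖x‖ ^ (-τ) * (‖x‖ ^ (-τ) / ‖x‖) := by
    rw [← Real.rpow_sub_one hr.ne', ← Real.rpow_add hr]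
    congr 1
    ring
  have hrhs : 27 * (18 * C * (3 * C)) * ‖x‖ ^ (-1 - 2 * τ) = 27 * (18 * ε * (3 * δ)) := by
    rw [hpow, hδ, hε]
    ring
  rw [hexpand, hrhs]
  have hsum : ∀ (f : Fin 3 → ℝ) (c : ℝ), (∀ i, |f i| ≤ c) → |∑ i, f i| ≤ 3 * c := fun f c h =>
    (Finset.abs_sum_le_sum_abs _ _).trans <|
      (Finset.sum_le_card_nsmul _ _ c fun i _ => h i).trans (by simp)
  calc _ ≤ 3 * (3 * (3 * (18 * ε * (3 * δ)))) :=
        hsum _ _ fun i => hsum _ _ fun j => hsum _ _ fun l => hterm i j l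
    _ = _ := by ring

end
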